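/- The closure of the convex hull of X equals the set of (x,y,t) ∈ [0,1]^N × ℝ₊^N × ℝ such that φ_{L,R,U}(x,y) ≤ t for every partition (L,R,U) of N⁺ and ψ_{L,R,U}(x,y) ≤ t for every partition (L,R,U) of N⁻. Here φ_{L,R,U}(x,y) is the optimal value of: minimize (y(L)−λ₀)²/(1−x(R)−x(U)+μ(R)+μ₀) + Σ_{i∈R} (y_i−λ_i)²/(x_i−μ_i) + (y(U)−y(N⁻)+λ₀+λ(R)+ζ)²/(x(U)−μ₀) over λ ∈ ℝ₊^R, μ ∈ ℝ₊^R, λ₀, μ₀, ζ ∈ ℝ₊ subject to 1−x(R)−x(U)+μ(R)+μ₀ ≥ 0, μ_i ≤ x_i for all i ∈ R, μ₀ ≤ x(U); and ψ_{L,R,U} is defined identically with the roles of N⁺ and N⁻ interchanged (so L, R, U partition N⁻ and y(N⁻) is replaced by y(N⁺)). -/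

import Mathlib

open Finset

noncomputable section

variable {ι : Type*}

/-- Extended-real ratio with the conventions `a/0 = +∞` for `a > 0` and `0/0 = 0`
(and `a/0 = −∞` for `a < 0`, which never occurs in the statements below). -/
def ratio (a b : ℝ) : EReal :=
  if b = 0 then (if 0 < a then (⊤ : EReal) else if a < 0 then (⊥ : EReal) else (0 : EReal))
  else ((a / b : ℝ) : EReal)

/-- Objective of the extended formulation of the lifted supermodular inequality for the
partition `(L,R,U)`; `Nother` is the "other side" of the partition of `N`
(`N⁻` for the inequalities over `B⁺`, and `N⁺` for those over `B⁻`). -/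
def objX [Fintype ι] (Nother L R U : Finset ι) (x y : ι → ℝ)
    (lam mu : ι → ℝ) (lam0 mu0 zeta : ℝ) : EReal :=
  ratio (((∑ i ∈ L, y i) - lam0) ^ 2)
      (1 - (∑ i ∈ R, x i) - (∑ i ∈ U, x i) + (∑ i ∈ R, mu i) + mu0)
    + (∑ i ∈ R, ratio ((y i - lam i) ^ 2) (x i - mu i))
    + ratio (((∑ i ∈ U, y i) - (∑ i ∈ Nother, y i) + lam0 + (∑ i ∈ R, lam i) + zeta) ^ 2)
      ((∑ i ∈ U, x i) - mu0)

/-- Feasibility of `(λ, μ, λ₀, μ₀, ζ)` in the extended formulation: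
`λ, μ ∈ ℝ₊^R`, `λ₀, μ₀, ζ ∈ ℝ₊`, `1 − x(R) − x(U) + μ(R) + μ₀ ≥ 0`,
`μ_i ≤ x_i` for `i ∈ R`, and `μ₀ ≤ x(U)`. -/
def feasX [Fintype ι] (R U : Finset ι) (x : ι → ℝ)
    (lam mu : ι → ℝ) (lam0 mu0 zeta : ℝ) : Prop :=
  (∀ i, 0 ≤ lam i) ∧ (∀ i, 0 ≤ mu i) ∧ 0 ≤ lam0 ∧ 0 ≤ mu0 ∧ 0 ≤ zeta ∧
  0 ≤ 1 - (∑ i ∈ R, x i) - (∑ i ∈ U, x i) + (∑ i ∈ R, mu i) + mu0 ∧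
  (∀ i ∈ R, mu i ≤ x i) ∧ mu0 ≤ ∑ i ∈ U, x i

/-- `φ_{L,R,U}(x,y)`: the optimal value of the extended formulation. -/
def phiX [Fintype ι] (Nother L R U : Finset ι) (x y : ι → ℝ) : EReal :=
  sInf {v : EReal | ∃ lam mu : ι → ℝ, ∃ lam0 mu0 zeta : ℝ,
    feasX R U x lam mu lam0 mu0 zeta ∧ v = objX Nother L R U x y lam mu lam0 mu0 zeta}

/-- The rank-one set `X` associated with the partition `N = N⁺ ∪ N⁻`. -/
def XSet [Fintype ι] (Np Nm : Finset ι) : Set ((ι → ℝ) × (ι → ℝ) × ℝ) :=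
  {p | (∀ i, p.1 i = 0 ∨ p.1 i = 1) ∧ (∀ i, 0 ≤ p.2.1 i) ∧ 0 ≤ p.2.2 ∧
       ((∑ i ∈ Np, p.2.1 i) - (∑ i ∈ Nm, p.2.1 i)) ^ 2 ≤ p.2.2 ∧
       ∀ i, p.2.1 i * (1 - p.1 i) = 0}

/-- For `b ≥ 0`, `a² / b` is the supremum of the affine functions `k a - k² b / 4`. -/
lemma ratio_sq_le_iff {a b w : ℝ} (hb : 0 ≤ b) :
    ratio (a ^ 2) b ≤ (w : EReal) ↔ ∀ k : ℝ, k * a - k ^ 2 * b / 4 ≤ w := by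
  unfold ratio
  rcases hb.eq_or_lt with rfl | hb
  · rcases eq_or_ne a 0 with rfl | ha
    · simp
    · have ha2 : 0 < a ^ 2 := by positivity
      simp only [if_true, ha2, top_le_iff, EReal.coe_ne_top, false_iff, not_forall, not_le]
      refine ⟨(w + 1) / a, ?_⟩
      rw [div_mul_cancel₀ _ ha]
      linarith
  · rw [if_neg hb.ne', EReal.coe_le_coe_iff, div_le_iff₀ hb]
    constructor
    · intro h k
      have : (k * a - k ^ 2 * b / 4) * b ≤ w * b := by nlinarith [sq_nonneg (a - k * b / 2)]
      exact le_of_mul_le_mul_right this hb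
    · intro h
      have h1 := h (2 * a / b)
      have h2 : 2 * a / b * a - (2 * a / b) ^ 2 * b / 4 = a ^ 2 / b := by field_simp; ring
      rwa [h2, div_le_iff₀ hb] at h1

lemma coe_le_ratio_sq {a b : ℝ} (hb : 0 ≤ b) (k : ℝ) :
    ((k * a - k ^ 2 * b / 4 : ℝ) : EReal) ≤ ratio (a ^ 2) b := by
  induction h : ratio (a ^ 2) b with
  | bot =>
    have := (ratio_sq_le_iff (w := k * a - k ^ 2 * b / 4 - 1) hb).1 (h ▸ bot_le) k
    linarith
  | top => exact le_top
  | coe w => exact EReal.coe_le_coe_iff.2 ((ratio_sq_le_iff hb).1 h.le k)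

lemma coe_sum_eq_sum_coe (s : Finset ι) (f : ι → ℝ) :
    ((∑ i ∈ s, f i : ℝ) : EReal) = ∑ i ∈ s, (f i : EReal) :=
  map_sum (⟨⟨Real.toEReal, EReal.coe_zero⟩, EReal.coe_add⟩ : ℝ →+ EReal) f s

/-- The affine minorant of `φ_{L,R,∅}` with slopes `τ` on `L`, `β` on `R` and `B` on the other
side. -/
lemma affine_le_phiX [Fintype ι] (Nother L R : Finset ι) (x y β : ι → ℝ) {τ B : ℝ}
    (hτ : 0 ≤ τ) (hτB : τ ≤ B) (hβ : ∀ i ∈ R, τ ≤ β i ∧ β i ≤ B) :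
    ((τ * ∑ i ∈ L, y i + ∑ i ∈ R, β i * y i - B * ∑ i ∈ Nother, y i - τ ^ 2 / 4
        - ∑ i ∈ R, (β i ^ 2 - τ ^ 2) / 4 * x i : ℝ) : EReal) ≤ phiX Nother L R ∅ x y := by
  refine le_sInf ?_
  rintro _ ⟨lam, mu, lam0, mu0, zeta, ⟨hlam, hmu, hlam0, hmu0, hzeta, hb, hmux, hmu0x⟩, rfl⟩
  have hR : ((∑ i ∈ R, (β i * (y i - lam i) - β i ^ 2 * (x i - mu i) / 4) : ℝ) : EReal) ≤
      ∑ i ∈ R, ratio ((y i - lam i) ^ 2) (x i - mu i) := by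
    rw [coe_sum_eq_sum_coe]
    exact Finset.sum_le_sum fun i hi => coe_le_ratio_sq (sub_nonneg.2 (hmux i hi)) _
  refine le_trans ?_ (add_le_add (add_le_add (coe_le_ratio_sq hb τ) hR)
    (coe_le_ratio_sq (sub_nonneg.2 hmu0x) B))
  rw [← EReal.coe_add, ← EReal.coe_add, EReal.coe_le_coe_iff]
  have hsum : 0 ≤ ∑ i ∈ R, ((B - β i) * lam i + (β i ^ 2 - τ ^ 2) / 4 * mu i) := by
    refine Finset.sum_nonneg fun i hi => ?_
    obtain ⟨h1, h2⟩ := hβ i hi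
    have := mul_nonneg (sub_nonneg.2 h2) (hlam i)
    have : 0 ≤ (β i ^ 2 - τ ^ 2) / 4 := by nlinarith
    have := mul_nonneg this (hmu i)
    linarith
  have h0 : 0 ≤ (B - τ) * lam0 := mul_nonneg (sub_nonneg.2 hτB) hlam0
  have h1 : 0 ≤ B * zeta := mul_nonneg (hτ.trans hτB) hzeta
  have h2 : 0 ≤ (B ^ 2 - τ ^ 2) * mu0 := mul_nonneg (by nlinarith) hmu0
  have e1 : ∑ i ∈ R, (β i * (y i - lam i) - β i ^ 2 * (x i - mu i) / 4) =
      ∑ i ∈ R, β i * y i - ∑ i ∈ R, (β i ^ 2 - τ ^ 2) / 4 * x i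
      - τ ^ 2 / 4 * (∑ i ∈ R, x i - ∑ i ∈ R, mu i)
      - B * ∑ i ∈ R, lam i
      + ∑ i ∈ R, ((B - β i) * lam i + (β i ^ 2 - τ ^ 2) / 4 * mu i) := by
    simp only [Finset.mul_sum, ← Finset.sum_sub_distrib, ← Finset.sum_add_distrib]
    exact Finset.sum_congr rfl fun i _ => by ring
  rw [e1]
  simp only [Finset.sum_empty] at *
  nlinarith

/-- An affine inequality valid for `XSet Np Nm`, with coefficient `1` on `t` and a negative
coefficient on some `y i` with `i ∈ Np`, follows from the inequalities `φ_{L,R,∅} ≤ t`. -/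
lemma le_of_phiX_le [Fintype ι] [DecidableEq ι] {Np Nm : Finset ι} (hNdisj : Disjoint Np Nm)
    (hNunion : Np ∪ Nm = Finset.univ) {a b x y : ι → ℝ} {δ t : ℝ}
    (hx : ∀ i, 0 ≤ x i ∧ x i ≤ 1) (hy : ∀ i, 0 ≤ y i)
    (hneg : ∃ i ∈ Np, b i < 0) (h0 : δ ≤ ∑ i, min (a i) 0)
    (h1 : ∀ k ∈ Np, ∀ r, 0 ≤ r → δ ≤ ∑ i, min (a i) 0 + max (a k) 0 + b k * r + r ^ 2)
    (h2 : ∀ i ∈ Np, ∀ j ∈ Nm, 0 ≤ b i + b j)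
    (hφ : ∀ L R : Finset ι, Disjoint L R → L ∪ R = Np → phiX Nm L R ∅ x y ≤ (t : EReal)) :
    δ ≤ ∑ i, a i * x i + ∑ i, b i * y i + t := by
  obtain ⟨i₀, hi₀, hb₀⟩ := hneg
  obtain ⟨m, hm, hmax⟩ := Finset.exists_min_image Np b ⟨i₀, hi₀⟩
  have hB : 0 < -b m := by linarith [hmax i₀ hi₀]
  set A := ∑ i, min (a i) 0 with hA
  have hθ : 0 ≤ A - δ := sub_nonneg.2 h0
  set τ := min (2 * √(A - δ)) (-b m) with hτdef
  have hτ : 0 ≤ τ := le_min (by positivity) hB.le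
  have hτθ : τ ^ 2 / 4 ≤ A - δ := by
    have h : τ ≤ 2 * √(A - δ) := min_le_left _ _
    nlinarith [Real.sq_sqrt hθ, Real.sqrt_nonneg (A - δ)]
  have hfR : ∀ i ∈ Np.filter (fun i => ¬ -b i ≤ τ), τ ≤ -b i ∧ -b i ≤ -b m := by
    intro i hi
    rw [Finset.mem_filter, not_le] at hi
    exact ⟨hi.2.le, by linarith [hmax i hi.1]⟩
  have key := (affine_le_phiX Nm (Np.filter fun i => -b i ≤ τ) (Np.filter fun i => ¬ -b i ≤ τ)
    x y (fun i => -b i) hτ (min_le_right _ _) hfR).trans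
    (hφ _ _ (Finset.disjoint_filter_filter_not _ _ _) (Finset.filter_union_filter_not_eq _ _))
  rw [EReal.coe_le_coe_iff] at key
  have split : ∀ g : ι → ℝ, ∑ i, g i = ∑ i ∈ Np.filter (fun i => -b i ≤ τ), g i
      + ∑ i ∈ Np.filter (fun i => ¬ -b i ≤ τ), g i + ∑ i ∈ Nm, g i := by
    intro g
    rw [Finset.sum_filter_add_sum_filter_not, ← Finset.sum_union hNdisj, hNunion]
  have hax : A + ∑ i, max (a i) 0 * x i ≤ ∑ i, a i * x i := by
    rw [hA, ← Finset.sum_add_distrib]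
    refine Finset.sum_le_sum fun i _ => ?_
    obtain ⟨hx0, hx1⟩ := hx i
    rcases le_total (a i) 0 with h | h
    · rw [min_eq_left h, max_eq_right h]; nlinarith
    · rw [min_eq_right h, max_eq_left h]; linarith
  have hcost : ∑ i ∈ Np.filter (fun i => ¬ -b i ≤ τ), ((-b i) ^ 2 - τ ^ 2) / 4 * x i ≤
      ∑ i, max (a i) 0 * x i := by
    refine le_trans (Finset.sum_le_sum fun i hi => ?_)
      (Finset.sum_le_univ_sum_of_nonneg fun i => mul_nonneg (le_max_right _ _) (hx i).1)
    refine mul_le_mul_of_nonneg_right ?_ (hx i).1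
    obtain ⟨hiN, hiτ⟩ := Finset.mem_filter.1 hi
    rw [not_le] at hiτ
    have hτeq : τ = 2 * √(A - δ) := by
      rcases min_choice (2 * √(A - δ)) (-b m) with h | h
      · exact h
      · have := hmax i hiN
        linarith
    have := h1 i hiN (-b i / 2) (by linarith)
    have hsq : τ ^ 2 = 4 * (A - δ) := by rw [hτeq, mul_pow, Real.sq_sqrt hθ]; ring
    nlinarith
  have hL : -(τ * ∑ i ∈ Np.filter (fun i => -b i ≤ τ), y i) ≤
      ∑ i ∈ Np.filter (fun i => -b i ≤ τ), b i * y i := by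
    rw [Finset.mul_sum, ← Finset.sum_neg_distrib]
    refine Finset.sum_le_sum fun i hi => ?_
    have := (Finset.mem_filter.1 hi).2
    nlinarith [hy i]
  have hNm : -b m * ∑ i ∈ Nm, y i ≤ ∑ i ∈ Nm, b i * y i := by
    rw [Finset.mul_sum]
    exact Finset.sum_le_sum fun j hj =>
      mul_le_mul_of_nonneg_right (by linarith [h2 m hm j hj]) (hy j)
  have hR : ∑ i ∈ Np.filter (fun i => ¬ -b i ≤ τ), -b i * y i =
      -∑ i ∈ Np.filter (fun i => ¬ -b i ≤ τ), b i * y i := by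
    simp only [neg_mul, Finset.sum_neg_distrib]
  rw [split fun i => b i * y i]
  linarith

lemma XSet_comm [Fintype ι] (Np Nm : Finset ι) : XSet Np Nm = XSet Nm Np := by
  ext p
  unfold XSet
  rw [Set.mem_ofPred_eq, Set.mem_ofPred_eq, ← neg_sq (∑ i ∈ Np, p.2.1 i - _), neg_sub]

lemma nonneg_of_forall_lt_add_mul {u C d : ℝ} (h : ∀ r, 0 ≤ r → u < C + d * r) : 0 ≤ d := by
  by_contra! hd
  have h1 := h (|C - u| / -d) (div_nonneg (abs_nonneg _) (by linarith))
  have h2 : d * (|C - u| / -d) = -|C - u| := by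
    rw [div_neg, mul_neg, mul_div_cancel₀ _ hd.ne]
  have := le_abs_self (C - u)
  linarith

lemma le_of_forall_XSet_lt_of_neg [Fintype ι] [DecidableEq ι] {Np Nm : Finset ι}
    (hNdisj : Disjoint Np Nm) (hNunion : Np ∪ Nm = Finset.univ) {a b x y : ι → ℝ} {c u t : ℝ}
    (hX : ∀ p ∈ XSet Np Nm, u < ∑ i, a i * p.1 i + ∑ i, b i * p.2.1 i + c * p.2.2)
    (hx : ∀ i, 0 ≤ x i ∧ x i ≤ 1) (hy : ∀ i, 0 ≤ y i) (hneg : ∃ i ∈ Np, b i < 0)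
    (hφ : ∀ L R : Finset ι, Disjoint L R → L ∪ R = Np → phiX Nm L R ∅ x y ≤ (t : EReal)) :
    u ≤ ∑ i, a i * x i + ∑ i, b i * y i + c * t := by
  have hsingle : ∀ k ∈ Np, ∀ r, 0 ≤ r →
      u < ∑ i, min (a i) 0 + max (a k) 0 + b k * r + c * r ^ 2 := by
    intro k hk r hr
    have hk' : k ∉ Nm := Finset.disjoint_left.1 hNdisj hk
    have h := hX (fun i => if a i < 0 ∨ i = k then 1 else 0, Pi.single k r, r ^ 2) ⟨by
      intro i; dsimp only; split_ifs <;> simp, fun i => by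
      rcases eq_or_ne i k with rfl | h <;> simp [*], by positivity, by
      simp [hk, hk'], fun i => by
      rcases eq_or_ne i k with rfl | h <;> simp [*]⟩
    have e1 : ∑ i, a i * (if a i < 0 ∨ i = k then 1 else 0) =
        ∑ i, min (a i) 0 + max (a k) 0 := by
      have : max (a k) 0 = ∑ i, if i = k then max (a i) 0 else 0 := by simp
      rw [this, ← Finset.sum_add_distrib]
      refine Finset.sum_congr rfl fun i _ => ?_
      rcases lt_or_ge (a i) 0 with h | h
      · simp [h, h.le]
      · by_cases hik : i = k <;> simp [h, hik, h.not_gt]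
    have e2 : ∑ i, b i * (Pi.single k r : ι → ℝ) i = b k * r := by
      simp [Pi.single_apply]
    simp only at h
    rwa [e1, e2] at h
  have hzero : u < ∑ i, min (a i) 0 := by
    have h := hX (fun i => if a i < 0 then 1 else 0, 0, 0) ⟨by
      intro i; dsimp only; split_ifs <;> simp, by simp, le_rfl, by simp, by simp⟩
    simp only [Pi.zero_apply, mul_zero, Finset.sum_const_zero, add_zero] at h
    convert h using 2 with i
    split_ifs with hi
    · simp [hi.le]
    · simp [not_lt.1 hi]
  have hpair : ∀ i ∈ Np, ∀ j ∈ Nm, 0 ≤ b i + b j := by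
    intro i hi j hj
    refine nonneg_of_forall_lt_add_mul (u := u) (C := ∑ i, a i) fun r hr => ?_
    have hi' : i ∉ Nm := Finset.disjoint_left.1 hNdisj hi
    have hj' : j ∉ Np := Finset.disjoint_right.1 hNdisj hj
    have h := hX (1, Pi.single i r + Pi.single j r, 0) ⟨by simp, fun k => add_nonneg
      ((Pi.single_nonneg.2 hr : (0 : ι → ℝ) ≤ _) k) ((Pi.single_nonneg.2 hr : (0 : ι → ℝ) ≤ _) k),
      le_rfl, by simp [Finset.sum_add_distrib, hi, hi', hj, hj'], by simp⟩
    simp only [Pi.one_apply, mul_one, Pi.add_apply, mul_add, Finset.sum_add_distrib,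
      Pi.single_apply, mul_ite, mul_zero, Finset.sum_ite_eq', Finset.mem_univ, if_true] at h
    linarith
  have hc0 : 0 ≤ c := by
    refine nonneg_of_forall_lt_add_mul (u := u) (C := 0) fun r hr => ?_
    simpa using hX (0, 0, r) ⟨by simp, by simp, hr, by simpa using hr, by simp⟩
  have hc : 0 < c := by
    refine hc0.lt_of_ne ?_
    rintro rfl
    obtain ⟨i, hi, hbi⟩ := hneg
    refine hbi.not_ge (nonneg_of_forall_lt_add_mul (u := u)
      (C := ∑ i, min (a i) 0 + max (a i) 0) fun r hr => ?_)
    simpa using hsingle i hi r hr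
  have hmin : ∑ i, min (c⁻¹ * a i) 0 = c⁻¹ * ∑ i, min (a i) 0 := by
    rw [Finset.mul_sum]
    exact Finset.sum_congr rfl fun i _ => by rw [mul_min_of_nonneg _ _ (by positivity), mul_zero]
  have key := le_of_phiX_le hNdisj hNunion (a := fun i => c⁻¹ * a i) (b := fun i => c⁻¹ * b i)
    (δ := c⁻¹ * u) hx hy (hneg.imp fun i h => ⟨h.1, mul_neg_of_pos_of_neg (by positivity) h.2⟩)
    (by rw [hmin]; exact mul_le_mul_of_nonneg_left hzero.le (by positivity))
    (fun k hk r hr => by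
      have := mul_le_mul_of_nonneg_left (hsingle k hk r hr).le (inv_nonneg.2 hc0)
      have e : max (c⁻¹ * a k) 0 = c⁻¹ * max (a k) 0 := by
        rw [mul_max_of_nonneg _ _ (by positivity), mul_zero]
      rw [mul_add, inv_mul_cancel_left₀ hc.ne'] at this
      rw [hmin, e]
      linarith)
    (fun i hi j hj => by rw [← mul_add]; exact mul_nonneg (by positivity) (hpair i hi j hj)) hφ
  simp only [mul_assoc, ← Finset.mul_sum] at key
  have := mul_le_mul_of_nonneg_left key hc0
  field_simp at this
  linarith

lemma mem_closure_convexHull_of_phiX_le [Fintype ι] [DecidableEq ι] {Np Nm : Finset ι}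
    (hNdisj : Disjoint Np Nm) (hNunion : Np ∪ Nm = Finset.univ) {x y : ι → ℝ} {t : ℝ}
    (hx : ∀ i, 0 ≤ x i ∧ x i ≤ 1) (hy : ∀ i, 0 ≤ y i)
    (hφ : ∀ L R : Finset ι, Disjoint L R → L ∪ R = Np → phiX Nm L R ∅ x y ≤ (t : EReal))
    (hψ : ∀ L R : Finset ι, Disjoint L R → L ∪ R = Nm → phiX Np L R ∅ x y ≤ (t : EReal)) :
    (x, y, t) ∈ closure (convexHull ℝ (XSet Np Nm)) := by
  by_contra hp
  obtain ⟨f, u, hfp, hfX⟩ := geometric_hahn_banach_point_closed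
    (convex_convexHull ℝ (XSet Np Nm)).closure isClosed_closure hp
  set a : ι → ℝ := fun i => f (Pi.single i 1, 0, 0) with ha
  set b : ι → ℝ := fun i => f (0, Pi.single i 1, 0) with hb
  set c : ℝ := f (0, 0, 1) with hc
  have hf : ∀ p : (ι → ℝ) × (ι → ℝ) × ℝ,
      f p = ∑ i, a i * p.1 i + ∑ i, b i * p.2.1 i + c * p.2.2 := by
    rintro ⟨x, y, t⟩
    have e : ((x, y, t) : (ι → ℝ) × (ι → ℝ) × ℝ) =
        ∑ i, x i • ((Pi.single i 1, 0, 0) : (ι → ℝ) × (ι → ℝ) × ℝ)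
        + ∑ i, y i • ((0, Pi.single i 1, 0) : (ι → ℝ) × (ι → ℝ) × ℝ) + t • (0, 0, 1) := by
      ext i <;> simp [Prod.fst_sum, Prod.snd_sum, Finset.sum_apply, Pi.single_apply]
    rw [e, map_add, map_add, map_sum, map_sum]
    simp only [map_smul, smul_eq_mul, ← hc]
    rw [← e]
    simp only [mul_comm, ha, hb]
  have hX : ∀ p ∈ XSet Np Nm, u < ∑ i, a i * p.1 i + ∑ i, b i * p.2.1 i + c * p.2.2 :=
    fun p hp => hf p ▸ hfX p (subset_closure (subset_convexHull ℝ _ hp))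
  refine hfp.not_ge ?_
  rw [hf]
  by_cases hneg : ∃ i, b i < 0
  · obtain ⟨i, hi⟩ := hneg
    rcases Finset.mem_union.1 (hNunion ▸ Finset.mem_univ i : i ∈ Np ∪ Nm) with h | h
    · exact le_of_forall_XSet_lt_of_neg hNdisj hNunion hX hx hy ⟨i, h, hi⟩ hφ
    · exact le_of_forall_XSet_lt_of_neg hNdisj.symm (Finset.union_comm Nm Np ▸ hNunion)
        (XSet_comm Np Nm ▸ hX) hx hy ⟨i, h, hi⟩ hψ
  · push Not at hneg
    have ht : 0 ≤ t := by
      have h := (affine_le_phiX Nm Np ∅ x y 0 le_rfl le_rfl (by simp)).trans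
        (hφ Np ∅ (by simp) (by simp))
      simpa using h
    have hc0 : 0 ≤ c := by
      refine nonneg_of_forall_lt_add_mul (u := u) (C := 0) fun r hr => ?_
      simpa using hX (0, 0, r) ⟨by simp, by simp, hr, by simpa using hr, by simp⟩
    have h0 := hX (fun i => if a i < 0 then 1 else 0, 0, 0) ⟨by
      intro i; dsimp only; split_ifs <;> simp, by simp, le_rfl, by simp, by simp⟩
    have h1 : ∑ i, a i * (if a i < 0 then 1 else 0) ≤ ∑ i, a i * x i := by
      refine Finset.sum_le_sum fun i _ => ?_
      obtain ⟨hx0, hx1⟩ := hx i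
      split_ifs <;> nlinarith
    have h2 : 0 ≤ ∑ i, b i * y i := Finset.sum_nonneg fun i _ => mul_nonneg (hneg i) (hy i)
    have h3 := mul_nonneg hc0 ht
    simp only [Pi.zero_apply, mul_zero, Finset.sum_const_zero, add_zero] at h0
    linarith

/-- `IsLift Nother L R U x y t lam mu w lam0 mu0 zeta w0 w1` says that `(lam, mu, lam0, mu0, zeta)`
is feasible, vanishes off `R`, and that `w0`, `w i` and `w1` bound the ratios in the objective and
sum up to at most `t`. -/
def IsLift [Fintype ι] (Nother L R U : Finset ι) (x y : ι → ℝ) (t : ℝ) (lam mu w : ι → ℝ)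
    (lam0 mu0 zeta w0 w1 : ℝ) : Prop :=
  ((∀ i, 0 ≤ x i) ∧ (∀ i, x i ≤ 1) ∧ (∀ i, 0 ≤ y i)) ∧
  ((∀ i, 0 ≤ lam i) ∧ (∀ i, 0 ≤ mu i) ∧ 0 ≤ lam0 ∧ 0 ≤ mu0 ∧ 0 ≤ zeta) ∧
  ((∀ i ∉ R, lam i ≤ 0) ∧ (∀ i ∉ R, mu i ≤ 0) ∧ (∀ i ∉ R, w i ≤ 0) ∧ (∀ i ∉ R, 0 ≤ w i)) ∧
  (0 ≤ 1 - (∑ i ∈ R, x i) - (∑ i ∈ U, x i) + (∑ i ∈ R, mu i) + mu0 ∧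
    (∀ i ∈ R, mu i ≤ x i) ∧ mu0 ≤ ∑ i ∈ U, x i) ∧
  (∀ k : ℝ, k * ((∑ i ∈ L, y i) - lam0)
    - k ^ 2 * (1 - (∑ i ∈ R, x i) - (∑ i ∈ U, x i) + (∑ i ∈ R, mu i) + mu0) / 4 ≤ w0) ∧
  (∀ i ∈ R, ∀ k : ℝ, k * (y i - lam i) - k ^ 2 * (x i - mu i) / 4 ≤ w i) ∧
  (∀ k : ℝ, k * ((∑ i ∈ U, y i) - (∑ i ∈ Nother, y i) + lam0 + (∑ i ∈ R, lam i) + zeta)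
    - k ^ 2 * ((∑ i ∈ U, x i) - mu0) / 4 ≤ w1) ∧
  w0 + ∑ i ∈ R, w i + w1 ≤ t

/-- The set of all lifts, as a subset of a product space. -/
def liftSet [Fintype ι] (Nother L R U : Finset ι) :
    Set (((ι → ℝ) × (ι → ℝ) × ℝ) × (ι → ℝ) × (ι → ℝ) × (ι → ℝ) × ℝ × ℝ × ℝ × ℝ × ℝ) :=
  {z | IsLift Nother L R U z.1.1 z.1.2.1 z.1.2.2 z.2.1 z.2.2.1 z.2.2.2.1 z.2.2.2.2.1
    z.2.2.2.2.2.1 z.2.2.2.2.2.2.1 z.2.2.2.2.2.2.2.1 z.2.2.2.2.2.2.2.2}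

lemma convex_liftSet [Fintype ι] (Nother L R U : Finset ι) :
    Convex ℝ (liftSet Nother L R U) := by
  rintro ⟨⟨x, y, t⟩, lam, mu, w, lam0, mu0, zeta, w0, w1⟩
    ⟨⟨p1, p2, p3⟩, ⟨p4, p5, p6, p7, p8⟩, ⟨p9, p10, p11, p12⟩, ⟨p13, p14, p15⟩, p16, p17, p18, p19⟩
    ⟨⟨x', y', t'⟩, lam', mu', w', lam0', mu0', zeta', w0', w1'⟩
    ⟨⟨q1, q2, q3⟩, ⟨q4, q5, q6, q7, q8⟩, ⟨q9, q10, q11, q12⟩, ⟨q13, q14, q15⟩, q16, q17, q18, q19⟩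
    a b ha hb hab
  obtain rfl : b = 1 - a := by linarith
  have comb : ∀ {l r l' r' : ℝ}, l ≤ r → l' ≤ r' → a * l + (1 - a) * l' ≤ a * r + (1 - a) * r' :=
    fun h h' => add_le_add (mul_le_mul_of_nonneg_left h ha) (mul_le_mul_of_nonneg_left h' hb)
  dsimp only at *
  refine ⟨⟨fun i => ?_, fun i => ?_, fun i => ?_⟩, ⟨fun i => ?_, fun i => ?_, ?_, ?_, ?_⟩,
    ⟨fun i hi => ?_, fun i hi => ?_, fun i hi => ?_, fun i hi => ?_⟩, ⟨?_, fun i hi => ?_, ?_⟩,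
    fun k => ?_, fun i hi k => ?_, fun k => ?_, ?_⟩ <;>
  simp only [Prod.smul_mk, Prod.mk_add_mk, Pi.add_apply, Pi.smul_apply, smul_eq_mul,
    Finset.sum_add_distrib, ← Finset.mul_sum]
  · linarith [comb (p1 i) (q1 i)]
  · linarith [comb (p2 i) (q2 i)]
  · linarith [comb (p3 i) (q3 i)]
  · linarith [comb (p4 i) (q4 i)]
  · linarith [comb (p5 i) (q5 i)]
  · linarith [comb p6 q6]
  · linarith [comb p7 q7]
  · linarith [comb p8 q8]
  · linarith [comb (p9 i hi) (q9 i hi)]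
  · linarith [comb (p10 i hi) (q10 i hi)]
  · linarith [comb (p11 i hi) (q11 i hi)]
  · linarith [comb (p12 i hi) (q12 i hi)]
  · linarith [comb p13 q13]
  · linarith [comb (p14 i hi) (q14 i hi)]
  · linarith [comb p15 q15]
  · linarith [comb (p16 k) (q16 k)]
  · linarith [comb (p17 i hi k) (q17 i hi k)]
  · linarith [comb (p18 k) (q18 k)]
  · linarith [comb p19 q19]

lemma isClosed_liftSet [Fintype ι] (Nother L R U : Finset ι) :
    IsClosed (liftSet Nother L R U) := by
  unfold liftSet IsLift
  simp only [Set.ofPred_and, Set.ofPred_forall]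
  repeat' first
    | apply IsClosed.inter
    | (refine isClosed_iInter fun _ => ?_)
    | exact isClosed_le (by fun_prop) (by fun_prop)

/-- A lift built from masses `mL`, `m i`, `mU` with total `s`, each given measure proportional to
its size. -/
lemma exists_isLift_of_masses [Fintype ι] [DecidableEq ι] {Nother L R U : Finset ι} {x y m : ι → ℝ}
    {t s mL mU : ℝ} (hx : ∀ i, 0 ≤ x i ∧ x i ≤ 1) (hy : ∀ i, 0 ≤ y i) (hs : 0 < s)
    (hst : s ^ 2 ≤ t) (hsy : s = ∑ i ∈ L, y i + ∑ i ∈ R, y i + ∑ i ∈ U, y i - ∑ i ∈ Nother, y i)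
    (hm : ∀ i ∈ R, 0 ≤ m i ∧ m i ≤ y i ∧ m i / s ≤ x i) (hmL : 0 ≤ mL) (hmLy : mL ≤ ∑ i ∈ L, y i)
    (hmU : 0 ≤ mU) (hmUx : mU / s ≤ ∑ i ∈ U, x i) (hsum : mL + ∑ i ∈ R, m i + mU = s) :
    ∃ (lam mu w : ι → ℝ) (lam0 mu0 zeta w0 w1 : ℝ),
      IsLift Nother L R U x y t lam mu w lam0 mu0 zeta w0 w1 := by
  have cone : ∀ {a : ℝ}, 0 ≤ a → ∀ k : ℝ, k * a - k ^ 2 * (a / s) / 4 ≤ s * a := by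
    intro a ha k
    have h : s * a - (k * a - k ^ 2 * (a / s) / 4) = a / s * (s - k / 2) ^ 2 := by
      field_simp; ring
    have : 0 ≤ a / s * (s - k / 2) ^ 2 := by positivity
    linarith
  have onR : ∀ f g : ι → ℝ, ∑ i ∈ R, (if i ∈ R then f i - g i else 0) =
      ∑ i ∈ R, f i - ∑ i ∈ R, g i := fun f g => by
    rw [← Finset.sum_sub_distrib]
    exact Finset.sum_congr rfl fun i hi => if_pos hi
  have hdiv : (∑ i ∈ R, m i / s) + mU / s = 1 - mL / s := by
    rw [← Finset.sum_div]
    field_simp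
    linarith
  have hb0 : 1 - (∑ i ∈ R, x i) - (∑ i ∈ U, x i) + (∑ i ∈ R, if i ∈ R then x i - m i / s else 0)
      + (∑ i ∈ U, x i - mU / s) = mL / s := by
    rw [onR]; linarith
  refine ⟨fun i => if i ∈ R then y i - m i else 0, fun i => if i ∈ R then x i - m i / s else 0,
    fun i => if i ∈ R then s * m i else 0, ∑ i ∈ L, y i - mL, ∑ i ∈ U, x i - mU / s, 0,
    s * mL, s * mU, ⟨fun i => (hx i).1, fun i => (hx i).2, hy⟩, ⟨fun i => ?_, fun i => ?_,
    by linarith, by linarith, le_rfl⟩, ⟨fun i hi => ?_, fun i hi => ?_, fun i hi => ?_,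
    fun i hi => ?_⟩, ⟨?_, fun i hi => ?_, ?_⟩, fun k => ?_, fun i hi k => ?_, fun k => ?_, ?_⟩
  · dsimp only; split_ifs with hi
    exacts [sub_nonneg.2 (hm i hi).2.1, le_rfl]
  · dsimp only; split_ifs with hi
    exacts [sub_nonneg.2 (hm i hi).2.2, le_rfl]
  · simp [hi]
  · simp [hi]
  · simp [hi]
  · simp [hi]
  · rw [hb0]; positivity
  · have := (hm i hi).1
    simp only [hi, if_true, sub_le_self_iff]; positivity
  · simp only [sub_le_self_iff]; positivity
  · rw [hb0, sub_sub_cancel]; exact cone hmL k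
  · simp only [hi, if_true, sub_sub_cancel]; exact cone (hm i hi).1 k
  · have e : ∑ i ∈ U, y i - ∑ i ∈ Nother, y i + (∑ i ∈ L, y i - mL)
        + (∑ i ∈ R, if i ∈ R then y i - m i else 0) + 0 = mU := by
      rw [onR]; linarith
    rw [e, sub_sub_cancel]; exact cone hmU k
  · have e : (∑ i ∈ R, if i ∈ R then s * m i else 0) = s * ∑ i ∈ R, m i := by
      rw [Finset.mul_sum]; exact Finset.sum_congr rfl fun i hi => if_pos hi
    rw [e, ← mul_add, ← mul_add, hsum, ← sq]; exact hst

lemma exists_isLift_of_mem_XSet [Fintype ι] [DecidableEq ι] {Np Nm L R U : Finset ι}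
    (hLR : Disjoint L R) (hLU : Disjoint L U) (hRU : Disjoint R U) (hN : L ∪ R ∪ U = Np)
    {x y : ι → ℝ} {t : ℝ} (hp : (x, y, t) ∈ XSet Np Nm) :
    ∃ (lam mu w : ι → ℝ) (lam0 mu0 zeta w0 w1 : ℝ),
      IsLift Nm L R U x y t lam mu w lam0 mu0 zeta w0 w1 := by
  obtain ⟨hx01, hy, ht, hst, hxy⟩ := hp
  dsimp only at hx01 hy ht hst hxy
  have hx : ∀ i, 0 ≤ x i ∧ x i ≤ 1 := fun i => by rcases hx01 i with h | h <;> simp [h]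
  have hy0 : ∀ i, x i = 0 → y i = 0 := fun i h => by simpa [h] using hxy i
  have hpos : ∀ S : Finset ι, 0 ≤ ∑ i ∈ S, y i := fun S => Finset.sum_nonneg fun i _ => hy i
  rw [← hN, Finset.sum_union (Finset.disjoint_union_left.2 ⟨hLU, hRU⟩),
    Finset.sum_union hLR] at hst
  set s := ∑ i ∈ L, y i + ∑ i ∈ R, y i + ∑ i ∈ U, y i - ∑ i ∈ Nm, y i with hs
  rcases le_or_gt s 0 with hs0 | hs0
  · have onR : ∀ f : ι → ℝ, ∑ i ∈ R, (if i ∈ R then f i else 0) = ∑ i ∈ R, f i :=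
      fun f => Finset.sum_congr rfl fun i hi => if_pos hi
    refine ⟨fun i => if i ∈ R then y i else 0, fun i => if i ∈ R then x i else 0, 0,
      ∑ i ∈ L, y i, ∑ i ∈ U, x i, -s, 0, 0, ⟨fun i => (hx i).1, fun i => (hx i).2, hy⟩,
      ⟨fun i => ?_, fun i => ?_, hpos L, Finset.sum_nonneg fun i _ => (hx i).1, by linarith⟩,
      ⟨fun i hi => by simp [hi], fun i hi => by simp [hi], by simp, by simp⟩,
      ⟨?_, fun i hi => by simp [hi], le_rfl⟩, fun k => ?_, fun i hi k => by simp [hi],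
      fun k => ?_, by simpa using ht⟩
    · dsimp only; split_ifs; exacts [hy i, le_rfl]
    · dsimp only; split_ifs; exacts [(hx i).1, le_rfl]
    · rw [onR]; linarith
    · rw [onR]; nlinarith [sq_nonneg k]
    · rw [onR, hs]; exact le_of_eq (by ring)
  rcases le_or_gt 1 (∑ i ∈ U, x i) with hU | hU
  · exact exists_isLift_of_masses (m := 0) (mL := 0) (mU := s) hx hy hs0 hst hs
      (fun i _ => ⟨le_rfl, hy i, by simpa using (hx i).1⟩) le_rfl (hpos L) hs0.le
      (by rwa [div_self hs0.ne']) (by simp)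
  have hyU : ∑ i ∈ U, y i = 0 := Finset.sum_eq_zero fun i hi => hy0 i <| by
    refine (hx01 i).resolve_right fun h => ?_
    have := Finset.single_le_sum (fun j _ => (hx j).1) hi
    linarith
  set T := ∑ i ∈ L, y i + ∑ i ∈ R, y i with hT
  have hsT : s ≤ T := by linarith [hpos Nm]
  have hT0 : 0 < T := hs0.trans_le hsT
  have hc1 : s / T ≤ 1 := (div_le_one hT0).2 hsT
  have hc0 : 0 ≤ s / T := by positivity
  refine exists_isLift_of_masses (m := fun i => s / T * y i) (mL := s / T * ∑ i ∈ L, y i)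
    (mU := 0) hx hy hs0 hst hs (fun i hi => ⟨mul_nonneg hc0 (hy i),
      mul_le_of_le_one_left (hy i) hc1, ?_⟩) (mul_nonneg hc0 (hpos L))
    (mul_le_of_le_one_left (hpos L) hc1) le_rfl
    (by simpa using Finset.sum_nonneg fun i _ => (hx i).1) ?_
  · rcases hx01 i with h | h
    · simp [h, hy0 i h]
    · have h1 : s / T * y i / s = y i / T := by field_simp
      rw [h, h1, div_le_one hT0]
      linarith [Finset.single_le_sum (fun j _ => hy j) hi, hpos L]
  · rw [← Finset.mul_sum, add_zero, ← mul_add, ← hT, div_mul_cancel₀ _ hT0.ne']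

lemma IsLift.phiX_le [Fintype ι] {Nother L R U : Finset ι} {x y : ι → ℝ} {t : ℝ}
    {lam mu w : ι → ℝ} {lam0 mu0 zeta w0 w1 : ℝ}
    (h : IsLift Nother L R U x y t lam mu w lam0 mu0 zeta w0 w1) :
    phiX Nother L R U x y ≤ (t : EReal) := by
  obtain ⟨-, ⟨hlam, hmu, hlam0, hmu0, hzeta⟩, -, ⟨hb, hmux, hmu0x⟩, h0, hR, h1, ht⟩ := h
  have hφ : phiX Nother L R U x y ≤ objX Nother L R U x y lam mu lam0 mu0 zeta := by
    refine sInf_le ?_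
    exact ⟨lam, mu, lam0, mu0, zeta, ⟨hlam, hmu, hlam0, hmu0, hzeta, hb, hmux, hmu0x⟩, rfl⟩
  refine (hφ.trans <| add_le_add (add_le_add ((ratio_sq_le_iff hb).2 h0)
    (Finset.sum_le_sum fun i hi => (ratio_sq_le_iff (sub_nonneg.2 (hmux i hi))).2 (hR i hi)))
    ((ratio_sq_le_iff (sub_nonneg.2 hmu0x)).2 h1)).trans ?_
  rw [← coe_sum_eq_sum_coe, ← EReal.coe_add, ← EReal.coe_add]
  exact EReal.coe_le_coe_iff.2 ht

lemma abs_le_of_cone {a b w M : ℝ} (hb1 : b ≤ 1) (hw : w ≤ M)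
    (h : ∀ k : ℝ, k * a - k ^ 2 * b / 4 ≤ w) : |a| ≤ M + 1 := by
  rw [abs_le]
  constructor <;> nlinarith [h 1, h (-1)]

/-- Lifts of points in a bounded set lie in a box. -/
lemma IsLift.mem_box [Fintype ι] [DecidableEq ι] {Nother L R U : Finset ι}
    {x y : ι → ℝ} {t : ℝ} {lam mu w : ι → ℝ} {lam0 mu0 zeta w0 w1 M : ℝ}
    (h : IsLift Nother L R U x y t lam mu w lam0 mu0 zeta w0 w1) (hyM : ∑ i, y i ≤ M)
    (htM : t ≤ M) :
    (((x, y, t), lam, mu, w, lam0, mu0, zeta, w0, w1) :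
      ((ι → ℝ) × (ι → ℝ) × ℝ) × (ι → ℝ) × (ι → ℝ) × (ι → ℝ) × ℝ × ℝ × ℝ × ℝ × ℝ) ∈
      Set.Icc 0 ((fun _ => 1, fun _ => M, M), fun _ => 2 * M + 1, fun _ => 1, fun _ => M,
        2 * M + 1, (Fintype.card ι : ℝ), 2 * M + 1, M, M) := by
  obtain ⟨⟨hx0, hx1, hy⟩, ⟨hlam, hmu, hlam0, hmu0, hzeta⟩, ⟨hlam', hmu', hw', hw''⟩,
    ⟨hb, hmux, hmu0x⟩, h0, hR, h1, ht⟩ := h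
  have hyS : ∀ S : Finset ι, ∑ i ∈ S, y i ≤ M := fun S =>
    (Finset.sum_le_univ_sum_of_nonneg hy).trans hyM
  have hyS0 : ∀ S : Finset ι, 0 ≤ ∑ i ∈ S, y i := fun S => Finset.sum_nonneg fun i _ => hy i
  have hM : 0 ≤ M := by simpa using hyS ∅
  have hyi : ∀ i, y i ≤ M := fun i => by simpa using hyS {i}
  have hw0 : 0 ≤ w0 := by simpa using h0 0
  have hw1 : 0 ≤ w1 := by simpa using h1 0
  have hw : ∀ i, 0 ≤ w i := fun i => by
    by_cases hi : i ∈ R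
    · simpa using hR i hi 0
    · exact hw'' i hi
  have hwR : 0 ≤ ∑ i ∈ R, w i := Finset.sum_nonneg fun i _ => hw i
  have hwi : ∀ i ∈ R, w i ≤ M := fun i hi => by
    linarith [Finset.single_le_sum (fun j _ => hw j) hi]
  have hxmu : 0 ≤ ∑ i ∈ R, (x i - mu i) :=
    Finset.sum_nonneg fun i hi => sub_nonneg.2 (hmux i hi)
  rw [Finset.sum_sub_distrib] at hxmu
  have a0 := abs_le.1 (abs_le_of_cone (M := M) (by linarith) (by linarith) h0)
  have aR : ∀ i ∈ R, |y i - lam i| ≤ M + 1 := fun i hi =>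
    abs_le_of_cone (by linarith [hx1 i, hmu i]) (hwi i hi) (hR i hi)
  have a1 := abs_le.1 (abs_le_of_cone (M := M) (by linarith) (by linarith) h1)
  have hlamR : 0 ≤ ∑ i ∈ R, lam i := Finset.sum_nonneg fun i _ => hlam i
  have hxU : ∑ i ∈ U, x i ≤ Fintype.card ι := by
    refine (Finset.sum_le_univ_sum_of_nonneg hx0).trans ?_
    simpa using Finset.sum_le_sum fun i (_ : i ∈ Finset.univ) => hx1 i
  have ht0 : 0 ≤ t := by linarith
  refine ⟨⟨⟨hx0, hy, ht0⟩, hlam, hmu, hw, hlam0, hmu0, hzeta, hw0, hw1⟩,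
    ⟨hx1, hyi, htM⟩, fun i => ?_, fun i => ?_, fun i => ?_, ?_, hmu0x.trans hxU, ?_, ?_, ?_⟩
  · dsimp only
    by_cases hi : i ∈ R
    · linarith [abs_le.1 (aR i hi), hyi i]
    · linarith [hlam' i hi]
  · dsimp only
    by_cases hi : i ∈ R
    · linarith [hmux i hi, hx1 i]
    · linarith [hmu' i hi]
  · dsimp only
    by_cases hi : i ∈ R
    · exact hwi i hi
    · linarith [hw' i hi]
  · dsimp only; linarith [hyS L]
  · dsimp only; linarith [hyS Nother, hyS0 U]
  · dsimp only; linarith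
  · dsimp only; linarith

lemma isClosed_image_fst_liftSet [Fintype ι] [DecidableEq ι] (Nother L R U : Finset ι) :
    IsClosed (Prod.fst '' liftSet Nother L R U) := by
  refine isClosed_of_closure_subset fun p hp => ?_
  set M := max (∑ i, p.2.1 i) p.2.2 + 1 with hM
  set V : Set ((ι → ℝ) × (ι → ℝ) × ℝ) := {q | ∑ i, q.2.1 i < M ∧ q.2.2 < M} with hV
  have hVo : IsOpen V := by
    rw [hV, Set.ofPred_and]
    exact (isOpen_lt (by fun_prop) (by fun_prop)).inter (isOpen_lt (by fun_prop) (by fun_prop))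
  have hpV : p ∈ V := ⟨by linarith [le_max_left (∑ i, p.2.1 i) p.2.2],
    by linarith [le_max_right (∑ i, p.2.1 i) p.2.2]⟩
  set B : Set (((ι → ℝ) × (ι → ℝ) × ℝ) × (ι → ℝ) × (ι → ℝ) × (ι → ℝ) × ℝ × ℝ × ℝ × ℝ × ℝ) :=
    Set.Icc 0 ((fun _ => 1, fun _ => M, M), fun _ => 2 * M + 1, fun _ => 1, fun _ => M,
        2 * M + 1, (Fintype.card ι : ℝ), 2 * M + 1, M, M) with hB
  have hK : IsClosed (Prod.fst '' (liftSet Nother L R U ∩ B)) :=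
    ((isCompact_Icc.inter_left (isClosed_liftSet Nother L R U)).image continuous_fst).isClosed
  have hsub : V ∩ Prod.fst '' liftSet Nother L R U ⊆
      Prod.fst '' (liftSet Nother L R U ∩ B) := by
    rintro _ ⟨hq, z, hz, rfl⟩
    exact ⟨z, ⟨hz, IsLift.mem_box hz hq.1.le hq.2.le⟩, rfl⟩
  exact Set.image_mono Set.inter_subset_left
    (closure_minimal hsub hK (hVo.inter_closure ⟨hpV, hp⟩))

lemma exists_isLift_of_mem_closure [Fintype ι] [DecidableEq ι] {Np Nm L R U : Finset ι}
    (hLR : Disjoint L R) (hLU : Disjoint L U) (hRU : Disjoint R U) (hN : L ∪ R ∪ U = Np)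
    {p : (ι → ℝ) × (ι → ℝ) × ℝ} (hp : p ∈ closure (convexHull ℝ (XSet Np Nm))) :
    ∃ (lam mu w : ι → ℝ) (lam0 mu0 zeta w0 w1 : ℝ),
      IsLift Nm L R U p.1 p.2.1 p.2.2 lam mu w lam0 mu0 zeta w0 w1 := by
  have hsub : closure (convexHull ℝ (XSet Np Nm)) ⊆ Prod.fst '' liftSet Nm L R U := by
    refine closure_minimal (convexHull_min ?_ ?_) (isClosed_image_fst_liftSet Nm L R U)
    · rintro ⟨x, y, t⟩ hq
      obtain ⟨lam, mu, w, lam0, mu0, zeta, w0, w1, h⟩ :=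
        exists_isLift_of_mem_XSet hLR hLU hRU hN hq
      exact ⟨((x, y, t), lam, mu, w, lam0, mu0, zeta, w0, w1), h, rfl⟩
    · exact (convex_liftSet Nm L R U).linear_image (LinearMap.fst ℝ _ _)
  obtain ⟨z, hz, rfl⟩ := hsub hp
  exact ⟨_, _, _, _, _, _, _, _, hz⟩

/-- main result. The closed convex hull of `X` equals the set of
`(x,y,t) ∈ [0,1]^N × ℝ₊^N × ℝ` satisfying `φ_{L,R,U}(x,y) ≤ t` for every partition
`(L,R,U)` of `N⁺` and `ψ_{L,R,U}(x,y) ≤ t` (the same with the roles of `N⁺` and `N⁻`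
interchanged) for every partition `(L,R,U)` of `N⁻`. -/
theorem stmt_18 [Fintype ι] [DecidableEq ι] (Np Nm : Finset ι)
    (hNdisj : Disjoint Np Nm) (hNunion : Np ∪ Nm = Finset.univ) :
    closure (convexHull ℝ (XSet Np Nm)) =
      {p : (ι → ℝ) × (ι → ℝ) × ℝ |
        (∀ i, 0 ≤ p.1 i ∧ p.1 i ≤ 1) ∧ (∀ i, 0 ≤ p.2.1 i) ∧
        (∀ L R U : Finset ι, Disjoint L R → Disjoint L U → Disjoint R U →
          L ∪ R ∪ U = Np → phiX Nm L R U p.1 p.2.1 ≤ ((p.2.2 : ℝ) : EReal)) ∧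
        (∀ L R U : Finset ι, Disjoint L R → Disjoint L U → Disjoint R U →
          L ∪ R ∪ U = Nm → phiX Np L R U p.1 p.2.1 ≤ ((p.2.2 : ℝ) : EReal))} := by
  refine Set.Subset.antisymm (fun p hp => ?_) ?_
  · obtain ⟨_, _, _, _, _, _, _, _, ⟨hx0, hx1, hy⟩, -⟩ := exists_isLift_of_mem_closure
      (Finset.disjoint_empty_right Np) (Finset.disjoint_empty_right Np)
      (Finset.disjoint_empty_right ∅) (by simp) hp
    refine ⟨fun i => ⟨hx0 i, hx1 i⟩, hy, fun L R U hLR hLU hRU hN => ?_,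
      fun L R U hLR hLU hRU hN => ?_⟩
    · obtain ⟨_, _, _, _, _, _, _, _, h⟩ := exists_isLift_of_mem_closure hLR hLU hRU hN hp
      exact h.phiX_le
    · rw [XSet_comm] at hp
      obtain ⟨_, _, _, _, _, _, _, _, h⟩ := exists_isLift_of_mem_closure hLR hLU hRU hN hp
      exact h.phiX_le
  · rintro ⟨x, y, t⟩ ⟨hx, hy, hφ, hψ⟩
    exact mem_closure_convexHull_of_phiX_le hNdisj hNunion hx hy
      (fun L R hLR hN => hφ L R ∅ hLR (by simp) (by simp) (by simpa using hN))
      (fun L R hLR hN => hψ L R ∅ hLR (by simp) (by simp) (by simpa using hN))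

end
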